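/- Let Ω ⊆ ℝ² be open, let H ∈ C¹(ℝ^m,ℝ^m) with ∂_iH_j = ∂_jH_i, and let u = (u_1,…,u_m), u_i ∈ C³(Ω), be a stable solution of Δ_G u_i = H_i(u) in Ω. Then the geometric Poincaré inequality holds: for all ζ_1,…,ζ_m ∈ C²(Ω) with compact support in Ω, Σ_i ∫_{Ω∩{|∇_G u_i|≠0}} |∇_G u_i|²·(𝒜(u_i)² + ℬ(u_i)²)·ζ_i² − 2Σ_i ∫_Ω [(Z(Yu_i))·(Xu_i) − (Z(Xu_i))·(Yu_i)]·ζ_i² + Σ_{i≠j} ∫_Ω ∂_jH_i(u)·[((Xu_i)(Xu_j) + (Yu_i)(Yu_j))·ζ_i² − |∇_G u_i|·|∇_G u_j|·ζ_i·ζ_j] ≤ Σ_i ∫_Ω |∇_G u_i|²·((Xζ_i)² + (Yζ_i)²). -/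

import Mathlib

open MeasureTheory Real Filter

/-- Partial derivative in the `x`-variable. -/
noncomputable def pdx (u : ℝ × ℝ → ℝ) (p : ℝ × ℝ) : ℝ :=
  deriv (fun t => u (t, p.2)) p.1

/-- Partial derivative in the `y`-variable. -/
noncomputable def pdy (u : ℝ × ℝ → ℝ) (p : ℝ × ℝ) : ℝ :=
  deriv (fun t => u (p.1, t)) p.2

/-- The Grushin vector field `X u = ∂ₓ u`. -/
noncomputable def Xg (u : ℝ × ℝ → ℝ) (p : ℝ × ℝ) : ℝ := pdx u p

/-- The Grushin vector field `Y u = x·∂_y u`. -/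
noncomputable def Yg (u : ℝ × ℝ → ℝ) (p : ℝ × ℝ) : ℝ := p.1 * pdy u p

/-- The commutator field `Z u = ∂_y u`. -/
noncomputable def Zg (u : ℝ × ℝ → ℝ) (p : ℝ × ℝ) : ℝ := pdy u p

/-- The Grushin Laplacian `Δ_G u = X(Xu) + Y(Yu)`. -/
noncomputable def deltaG (u : ℝ × ℝ → ℝ) (p : ℝ × ℝ) : ℝ := Xg (Xg u) p + Yg (Yg u) p

/-- The norm of the Grushin gradient, `|∇_G u| = √((Xu)² + (Yu)²)`. -/
noncomputable def normG (u : ℝ × ℝ → ℝ) (p : ℝ × ℝ) : ℝ :=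
  Real.sqrt ((Xg u p) ^ 2 + (Yg u p) ^ 2)

/-- The `j`-th partial derivative of a function `H : ℝ^m → ℝ`. -/
noncomputable def pdH {m : ℕ} (H : (Fin m → ℝ) → ℝ) (j : Fin m) (v : Fin m → ℝ) : ℝ :=
  fderiv ℝ H v (Pi.single j 1)

/-- Intrinsic curvature `𝒜` of the level sets. -/
noncomputable def curvA (u : ℝ × ℝ → ℝ) (p : ℝ × ℝ) : ℝ :=
  ((normG u p) ^ 3)⁻¹ *
    (Xg (Xg u) p * (Yg u p) ^ 2 - Xg (Yg u) p * Xg u p * Yg u p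
      - Yg (Xg u) p * Xg u p * Yg u p + Yg (Yg u) p * (Xg u p) ^ 2)

/-- Intrinsic tangential quantity `ℬ` of the level sets. -/
noncomputable def curvB (u : ℝ × ℝ → ℝ) (p : ℝ × ℝ) : ℝ :=
  ((normG u p) ^ 3)⁻¹ *
    (Xg (Xg u) p * Xg u p * Yg u p - Xg (Yg u) p * (Xg u p) ^ 2
      + Yg (Xg u) p * (Yg u p) ^ 2 - Yg (Yg u) p * Xg u p * Yg u p)

/-- The Grushin ball `B_R = {(x,y) : x⁴ + y² < R⁴}`. -/
def ballG (R : ℝ) : Set (ℝ × ℝ) := {p : ℝ × ℝ | p.1 ^ 4 + p.2 ^ 2 < R ^ 4}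

/-- The Grushin norm `‖(x,y)‖_G = (x⁴+y²)^(1/4)`. -/
noncomputable def grushinNorm (p : ℝ × ℝ) : ℝ := (p.1 ^ 4 + p.2 ^ 2) ^ ((1 : ℝ) / 4)

theorem hasDerivAt_slice_fst {f : ℝ × ℝ → ℝ} {p : ℝ × ℝ} (hf : DifferentiableAt ℝ f p) :
    HasDerivAt (fun t => f (t, p.2)) (fderiv ℝ f p (1, 0)) p.1 :=
  HasFDerivAt.comp_hasDerivAt (f := fun t : ℝ => (t, p.2)) p.1 hf.hasFDerivAt
    ((hasDerivAt_id p.1).prodMk (hasDerivAt_const p.1 p.2))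

theorem hasDerivAt_slice_snd {f : ℝ × ℝ → ℝ} {p : ℝ × ℝ} (hf : DifferentiableAt ℝ f p) :
    HasDerivAt (fun t => f (p.1, t)) (fderiv ℝ f p (0, 1)) p.2 :=
  HasFDerivAt.comp_hasDerivAt (f := fun t : ℝ => (p.1, t)) p.2 hf.hasFDerivAt
    ((hasDerivAt_const p.2 p.1).prodMk (hasDerivAt_id p.2))

theorem pdx_eq_fderiv {f : ℝ × ℝ → ℝ} {p : ℝ × ℝ} (hf : DifferentiableAt ℝ f p) :
    pdx f p = fderiv ℝ f p (1, 0) :=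
  (hasDerivAt_slice_fst hf).deriv

theorem pdy_eq_fderiv {f : ℝ × ℝ → ℝ} {p : ℝ × ℝ} (hf : DifferentiableAt ℝ f p) :
    pdy f p = fderiv ℝ f p (0, 1) :=
  (hasDerivAt_slice_snd hf).deriv

theorem hasDerivAt_pdx {f : ℝ × ℝ → ℝ} (hf : Differentiable ℝ f) (p : ℝ × ℝ) :
    HasDerivAt (fun t => f (t, p.2)) (pdx f p) p.1 :=
  pdx_eq_fderiv (hf p) ▸ hasDerivAt_slice_fst (hf p)

theorem hasDerivAt_pdy {f : ℝ × ℝ → ℝ} (hf : Differentiable ℝ f) (p : ℝ × ℝ) :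
    HasDerivAt (fun t => f (p.1, t)) (pdy f p) p.2 :=
  pdy_eq_fderiv (hf p) ▸ hasDerivAt_slice_snd (hf p)

theorem contDiff_pdx {f : ℝ × ℝ → ℝ} {n : WithTop ℕ∞} (hf : ContDiff ℝ (n + 1) f) :
    ContDiff ℝ n (pdx f) := by
  have h : pdx f = fun p => fderiv ℝ f p (1, 0) :=
    funext fun p => pdx_eq_fderiv (hf.differentiable (by simp) p)
  rw [h]
  exact (hf.fderiv_right le_rfl).clm_apply contDiff_const

theorem contDiff_pdy {f : ℝ × ℝ → ℝ} {n : WithTop ℕ∞} (hf : ContDiff ℝ (n + 1) f) :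
    ContDiff ℝ n (pdy f) := by
  have h : pdy f = fun p => fderiv ℝ f p (0, 1) :=
    funext fun p => pdy_eq_fderiv (hf.differentiable (by simp) p)
  rw [h]
  exact (hf.fderiv_right le_rfl).clm_apply contDiff_const

theorem pdx_pdy_comm {f : ℝ × ℝ → ℝ} (hf : ContDiff ℝ 2 f) : pdx (pdy f) = pdy (pdx f) := by
  have hd : Differentiable ℝ f := hf.differentiable (by simp)
  have h2 : Differentiable ℝ (fderiv ℝ f) :=
    (hf.fderiv_right (m := 1) (by norm_num)).differentiable (by simp)
  have key : ∀ (v w p : ℝ × ℝ), fderiv ℝ (fun q => fderiv ℝ f q v) p w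
      = fderiv ℝ (fderiv ℝ f) p w v := by
    intro v w p
    rw [fderiv_clm_apply (h2 p) (differentiableAt_const v)]
    simp
  have ex : pdx f = fun p => fderiv ℝ f p (1, 0) := funext fun p => pdx_eq_fderiv (hd p)
  have ey : pdy f = fun p => fderiv ℝ f p (0, 1) := funext fun p => pdy_eq_fderiv (hd p)
  have hs : ∀ v : ℝ × ℝ, Differentiable ℝ fun q => fderiv ℝ f q v :=
    fun v => h2.clm_apply (differentiable_const v)
  funext p
  rw [ex, ey, pdx_eq_fderiv (hs _ p), pdy_eq_fderiv (hs _ p), key, key]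
  exact hf.contDiffAt.isSymmSndFDerivAt (by simp) _ _

theorem pdx_congr {f g : ℝ × ℝ → ℝ} {V : Set (ℝ × ℝ)} (hV : IsOpen V) (h : Set.EqOn f g V) :
    Set.EqOn (pdx f) (pdx g) V := by
  intro p hp
  refine Filter.EventuallyEq.deriv_eq ?_
  have hc : ContinuousAt (fun t : ℝ => (t, p.2)) p.1 := by fun_prop
  filter_upwards [hc.eventually (hV.mem_nhds hp)] with t ht using h ht

theorem pdy_congr {f g : ℝ × ℝ → ℝ} {V : Set (ℝ × ℝ)} (hV : IsOpen V) (h : Set.EqOn f g V) :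
    Set.EqOn (pdy f) (pdy g) V := by
  intro p hp
  refine Filter.EventuallyEq.deriv_eq ?_
  have hc : ContinuousAt (fun t : ℝ => (p.1, t)) p.2 := by fun_prop
  filter_upwards [hc.eventually (hV.mem_nhds hp)] with t ht using h ht

theorem pdx_eq_zero_of_notMem_tsupport {f : ℝ × ℝ → ℝ} {p : ℝ × ℝ} (hp : p ∉ tsupport f) :
    pdx f p = 0 := by
  have h := pdx_congr (g := fun _ => 0) (isClosed_tsupport f).isOpen_compl
    (fun q hq => image_eq_zero_of_notMem_tsupport hq) hp
  simpa [pdx] using h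

theorem pdy_eq_zero_of_notMem_tsupport {f : ℝ × ℝ → ℝ} {p : ℝ × ℝ} (hp : p ∉ tsupport f) :
    pdy f p = 0 := by
  have h := pdy_congr (g := fun _ => 0) (isClosed_tsupport f).isOpen_compl
    (fun q hq => image_eq_zero_of_notMem_tsupport hq) hp
  simpa [pdy] using h

/-- A continuous function vanishing off the support of a compactly supported one is integrable. -/
theorem integrable_of_eq_zero_off_tsupport {f ζ : ℝ × ℝ → ℝ} (hζ : HasCompactSupport ζ)
    (hf : Continuous f) (h : ∀ p ∉ tsupport ζ, f p = 0) : Integrable f :=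
  hf.integrable_of_hasCompactSupport (HasCompactSupport.intro hζ h)

theorem integral_fderiv_eq_zero {f : ℝ × ℝ → ℝ} (hf : ContDiff ℝ 1 f)
    (hc : HasCompactSupport f) (v : ℝ × ℝ) : ∫ p, fderiv ℝ f p v = 0 := by
  have hi : Integrable fun p => fderiv ℝ f p v :=
    ((hf.continuous_fderiv (by simp)).clm_apply continuous_const).integrable_of_hasCompactSupport
      (hc.fderiv_apply (𝕜 := ℝ) v)
  have h := integral_mul_fderiv_eq_neg_fderiv_mul_of_integrable (μ := volume)
    (f := fun _ : ℝ × ℝ => (1 : ℝ)) (g := f) (v := v) (by simp) (by simpa using hi)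
    (by simpa using hf.continuous.integrable_of_hasCompactSupport hc)
    (fun x _ => differentiableAt_const _) (fun x _ => hf.differentiable (by simp) x)
  simpa using h

theorem integral_pdx_eq_zero {f : ℝ × ℝ → ℝ} (hf : ContDiff ℝ 1 f)
    (hc : HasCompactSupport f) : ∫ p, pdx f p = 0 := by
  rw [← integral_fderiv_eq_zero hf hc (1, 0)]
  exact congrArg _ (funext fun p => pdx_eq_fderiv (hf.differentiable (by simp) p))

theorem integral_pdy_eq_zero {f : ℝ × ℝ → ℝ} (hf : ContDiff ℝ 1 f)
    (hc : HasCompactSupport f) : ∫ p, pdy f p = 0 := by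
  rw [← integral_fderiv_eq_zero hf hc (0, 1)]
  exact congrArg _ (funext fun p => pdy_eq_fderiv (hf.differentiable (by simp) p))

open scoped Manifold in
/-- A function that is `C^n` on a neighbourhood of a compact set agrees near that set with a
globally `C^n` function. -/
theorem exists_contDiff_eqOn_nhds {n : ℕ∞} {ι : Type*} {Ω K : Set (ℝ × ℝ)} (hΩ : IsOpen Ω)
    (hK : IsCompact K) (hKΩ : K ⊆ Ω) (u : ι → ℝ × ℝ → ℝ) (hu : ∀ i, ContDiffOn ℝ n (u i) Ω) :
    ∃ V : Set (ℝ × ℝ), IsOpen V ∧ K ⊆ V ∧ V ⊆ Ω ∧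
      ∃ w : ι → ℝ × ℝ → ℝ, (∀ i, ContDiff ℝ n (w i)) ∧ ∀ i, Set.EqOn (w i) (u i) V := by
  obtain ⟨L, hL, hKL, hLΩ⟩ := exists_compact_between hK hΩ hKΩ
  obtain ⟨L', hL', hLL', hL'Ω⟩ := exists_compact_between hL hΩ hLΩ
  obtain ⟨χ, hχ0, hχ1, -⟩ := exists_contMDiffMap_zero_one_of_isClosed (n := n) 𝓘(ℝ, ℝ × ℝ)
    (isOpen_interior (s := L')).isClosed_compl hL.isClosed
    (Set.disjoint_left.2 fun x hx hxL => hx (hLL' hxL))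
  have hχ : ContDiff ℝ n χ := χ.contMDiff.contDiff
  refine ⟨interior L, isOpen_interior, hKL, interior_subset.trans hLΩ,
    fun i p => χ p * u i p, fun i => ?_, fun i p hp => ?_⟩
  · rw [contDiff_iff_contDiffAt]
    intro p
    by_cases hp : p ∈ L'
    · exact hχ.contDiffAt.mul ((hu i).contDiffAt (hΩ.mem_nhds (hL'Ω hp)))
    · refine (contDiffAt_const (c := (0 : ℝ))).congr_of_eventuallyEq ?_
      filter_upwards [hL'.isClosed.isOpen_compl.mem_nhds hp] with q hq
      simp [hχ0 (fun h => hq (interior_subset h) : q ∈ (interior L')ᶜ)]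
  · simp [hχ1 (interior_subset hp)]

theorem contDiff_Xg {f : ℝ × ℝ → ℝ} {n : WithTop ℕ∞} (hf : ContDiff ℝ (n + 1) f) :
    ContDiff ℝ n (Xg f) :=
  contDiff_pdx hf

theorem contDiff_Yg {f : ℝ × ℝ → ℝ} {n : WithTop ℕ∞} (hf : ContDiff ℝ (n + 1) f) :
    ContDiff ℝ n (Yg f) :=
  contDiff_fst.mul (contDiff_pdy hf)

theorem contDiff_Zg {f : ℝ × ℝ → ℝ} {n : WithTop ℕ∞} (hf : ContDiff ℝ (n + 1) f) :
    ContDiff ℝ n (Zg f) :=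
  contDiff_pdy hf

theorem Xg_congr {f g : ℝ × ℝ → ℝ} {V : Set (ℝ × ℝ)} (hV : IsOpen V) (h : Set.EqOn f g V) :
    Set.EqOn (Xg f) (Xg g) V :=
  pdx_congr hV h

theorem Yg_congr {f g : ℝ × ℝ → ℝ} {V : Set (ℝ × ℝ)} (hV : IsOpen V) (h : Set.EqOn f g V) :
    Set.EqOn (Yg f) (Yg g) V :=
  fun _ hp => congrArg _ (pdy_congr hV h hp)

theorem Zg_congr {f g : ℝ × ℝ → ℝ} {V : Set (ℝ × ℝ)} (hV : IsOpen V) (h : Set.EqOn f g V) :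
    Set.EqOn (Zg f) (Zg g) V :=
  pdy_congr hV h

theorem Xg_eq_zero_of_notMem_tsupport {f : ℝ × ℝ → ℝ} {p : ℝ × ℝ} (hp : p ∉ tsupport f) :
    Xg f p = 0 :=
  pdx_eq_zero_of_notMem_tsupport hp

theorem Yg_eq_zero_of_notMem_tsupport {f : ℝ × ℝ → ℝ} {p : ℝ × ℝ} (hp : p ∉ tsupport f) :
    Yg f p = 0 := by
  simp [Yg, pdy_eq_zero_of_notMem_tsupport hp]

theorem Xg_add {f g : ℝ × ℝ → ℝ} (hf : Differentiable ℝ f) (hg : Differentiable ℝ g) :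
    Xg (fun p => f p + g p) = fun p => Xg f p + Xg g p :=
  funext fun p => ((hasDerivAt_pdx hf p).add (hasDerivAt_pdx hg p)).deriv

theorem Zg_add {f g : ℝ × ℝ → ℝ} (hf : Differentiable ℝ f) (hg : Differentiable ℝ g) :
    Zg (fun p => f p + g p) = fun p => Zg f p + Zg g p :=
  funext fun p => ((hasDerivAt_pdy hf p).add (hasDerivAt_pdy hg p)).deriv

theorem Yg_add {f g : ℝ × ℝ → ℝ} (hf : Differentiable ℝ f) (hg : Differentiable ℝ g) :
    Yg (fun p => f p + g p) = fun p => Yg f p + Yg g p :=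
  funext fun p => (congrArg (p.1 * ·) (congrFun (Zg_add hf hg) p)).trans (mul_add _ _ _)

theorem Xg_Zg_comm {f : ℝ × ℝ → ℝ} (hf : ContDiff ℝ 2 f) : Xg (Zg f) = Zg (Xg f) :=
  pdx_pdy_comm hf

theorem Yg_Zg_comm (f : ℝ × ℝ → ℝ) : Zg (Yg f) = Yg (Zg f) :=
  funext fun p => deriv_const_mul_field p.1

/-- The commutation relation `[X, Y] = Z`. -/
theorem Xg_Yg_eq {f : ℝ × ℝ → ℝ} (hf : ContDiff ℝ 2 f) :
    Xg (Yg f) = fun p => Yg (Xg f) p + Zg f p := by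
  funext p
  have hq : Differentiable ℝ (pdy f) :=
    (contDiff_pdy (n := 1) (by norm_num; exact hf)).differentiable (by simp)
  have h := ((hasDerivAt_id p.1).mul (hasDerivAt_pdx hq p)).deriv
  have hc := congrFun (pdx_pdy_comm hf) p
  refine h.trans ?_
  simp only [Yg, Zg, id, hc]
  change _ = p.1 * pdy (pdx f) p + _
  ring

theorem Xg_deltaG {w : ℝ × ℝ → ℝ} (hw : ContDiff ℝ 3 w) (p : ℝ × ℝ) :
    Xg (deltaG w) p = Xg (Xg (Xg w)) p + Yg (Yg (Xg w)) p + 2 * Zg (Yg w) p := by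
  have hX : ContDiff ℝ 2 (Xg w) := contDiff_Xg (by norm_num; exact hw)
  have hY : ContDiff ℝ 2 (Yg w) := contDiff_Yg (by norm_num; exact hw)
  have hZ : ContDiff ℝ 2 (Zg w) := contDiff_Zg (by norm_num; exact hw)
  have d {f : ℝ × ℝ → ℝ} (hf : ContDiff ℝ 1 f) : Differentiable ℝ f := hf.differentiable (by simp)
  have h1 : Xg (deltaG w) = fun p => Xg (Xg (Xg w)) p + Xg (Yg (Yg w)) p :=
    Xg_add (d (contDiff_Xg (by norm_num; exact hX))) (d (contDiff_Yg (by norm_num; exact hY)))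
  have h2 := Xg_Yg_eq hY
  have h3 : Yg (Xg (Yg w)) = fun p => Yg (Yg (Xg w)) p + Yg (Zg w) p := by
    rw [Xg_Yg_eq (hw.of_le (by norm_num))]
    exact Yg_add (d (contDiff_Yg (by norm_num; exact hX))) (d (hZ.of_le (by norm_num)))
  rw [h1, h2, h3, Yg_Zg_comm]
  ring

theorem Yg_deltaG {w : ℝ × ℝ → ℝ} (hw : ContDiff ℝ 3 w) (p : ℝ × ℝ) :
    Yg (deltaG w) p = Xg (Xg (Yg w)) p + Yg (Yg (Yg w)) p - 2 * Zg (Xg w) p := by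
  have hX : ContDiff ℝ 2 (Xg w) := contDiff_Xg (by norm_num; exact hw)
  have hY : ContDiff ℝ 2 (Yg w) := contDiff_Yg (by norm_num; exact hw)
  have hZ : ContDiff ℝ 2 (Zg w) := contDiff_Zg (by norm_num; exact hw)
  have d {f : ℝ × ℝ → ℝ} (hf : ContDiff ℝ 1 f) : Differentiable ℝ f := hf.differentiable (by simp)
  have h1 : Yg (deltaG w) = fun p => Yg (Xg (Xg w)) p + Yg (Yg (Yg w)) p :=
    Yg_add (d (contDiff_Xg (by norm_num; exact hX))) (d (contDiff_Yg (by norm_num; exact hY)))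
  have h2 := congrFun (Xg_Yg_eq hX) p
  have h3 : Xg (Xg (Yg w)) = fun p => Xg (Yg (Xg w)) p + Xg (Zg w) p := by
    rw [Xg_Yg_eq (hw.of_le (by norm_num))]
    exact Xg_add (d (contDiff_Yg (by norm_num; exact hX))) (d (hZ.of_le (by norm_num)))
  rw [h1, h3, Xg_Zg_comm (hw.of_le (by norm_num))]
  linarith

/-- The divergence of `ζ² (a ∇_G a + b ∇_G b)`. -/
theorem pdx_add_pdy_flux {a b ζ : ℝ × ℝ → ℝ} (ha : ContDiff ℝ 2 a) (hb : ContDiff ℝ 2 b)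
    (hζ : ContDiff ℝ 1 ζ) (p : ℝ × ℝ) :
    pdx (fun p => (a p * Xg a p + b p * Xg b p) * ζ p ^ 2) p
      + pdy (fun p => p.1 * ((a p * Yg a p + b p * Yg b p) * ζ p ^ 2)) p
    = (Xg a p ^ 2 + Xg b p ^ 2 + Yg a p ^ 2 + Yg b p ^ 2) * ζ p ^ 2
      + (a p * (Xg (Xg a) p + Yg (Yg a) p) + b p * (Xg (Xg b) p + Yg (Yg b) p)) * ζ p ^ 2
      + 2 * ζ p * ((a p * Xg a p + b p * Xg b p) * Xg ζ p
        + (a p * Yg a p + b p * Yg b p) * Yg ζ p) := by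
  have d {f : ℝ × ℝ → ℝ} (hf : ContDiff ℝ 1 f) : Differentiable ℝ f := hf.differentiable (by simp)
  have da := d (ha.of_le (by norm_num))
  have db := d (hb.of_le (by norm_num))
  have dζ := d hζ
  have dXa := d (contDiff_Xg (n := 1) (by norm_num; exact ha))
  have dXb := d (contDiff_Xg (n := 1) (by norm_num; exact hb))
  have dYa := d (contDiff_Yg (n := 1) (by norm_num; exact ha))
  have dYb := d (contDiff_Yg (n := 1) (by norm_num; exact hb))
  have hx := ((((hasDerivAt_pdx da p).mul (hasDerivAt_pdx dXa p)).add
    ((hasDerivAt_pdx db p).mul (hasDerivAt_pdx dXb p))).mul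
      ((hasDerivAt_pdx dζ p).pow 2)).deriv
  have hy := (((((hasDerivAt_pdy da p).mul (hasDerivAt_pdy dYa p)).add
    ((hasDerivAt_pdy db p).mul (hasDerivAt_pdy dYb p))).mul
      ((hasDerivAt_pdy dζ p).pow 2)).const_mul p.1).deriv
  refine (congrArg₂ (· + ·) hx hy).trans ?_
  have e (f : ℝ × ℝ → ℝ) : Yg f p = p.1 * pdy f p := rfl
  rw [e (Yg a), e (Yg b), e ζ]
  simp only [Pi.mul_apply, Pi.add_apply, Pi.pow_apply, Prod.mk.eta, e, Xg]
  push_cast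
  ring

theorem integral_flux_eq_zero {a b ζ : ℝ × ℝ → ℝ} (ha : ContDiff ℝ 2 a) (hb : ContDiff ℝ 2 b)
    (hζ : ContDiff ℝ 1 ζ) (hc : HasCompactSupport ζ) :
    Integrable (fun p => pdx (fun p => (a p * Xg a p + b p * Xg b p) * ζ p ^ 2) p
      + pdy (fun p => p.1 * ((a p * Yg a p + b p * Yg b p) * ζ p ^ 2)) p) ∧
    ∫ p, (pdx (fun p => (a p * Xg a p + b p * Xg b p) * ζ p ^ 2) p
      + pdy (fun p => p.1 * ((a p * Yg a p + b p * Yg b p) * ζ p ^ 2)) p) = 0 := by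
  have cXa := contDiff_Xg (n := 1) (by norm_num; exact ha)
  have cXb := contDiff_Xg (n := 1) (by norm_num; exact hb)
  have cYa := contDiff_Yg (n := 1) (by norm_num; exact ha)
  have cYb := contDiff_Yg (n := 1) (by norm_num; exact hb)
  have ca := ha.of_le (show (1 : WithTop ℕ∞) ≤ 2 by norm_num)
  have cb := hb.of_le (show (1 : WithTop ℕ∞) ≤ 2 by norm_num)
  have c1 : ContDiff ℝ 1 fun p => (a p * Xg a p + b p * Xg b p) * ζ p ^ 2 := by fun_prop
  have c2 : ContDiff ℝ 1 fun p : ℝ × ℝ => p.1 * ((a p * Yg a p + b p * Yg b p) * ζ p ^ 2) := by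
    fun_prop
  have s1 : HasCompactSupport fun p => (a p * Xg a p + b p * Xg b p) * ζ p ^ 2 :=
    HasCompactSupport.intro hc fun p hp => by simp [image_eq_zero_of_notMem_tsupport hp]
  have s2 : HasCompactSupport fun p : ℝ × ℝ =>
      p.1 * ((a p * Yg a p + b p * Yg b p) * ζ p ^ 2) :=
    HasCompactSupport.intro hc fun p hp => by simp [image_eq_zero_of_notMem_tsupport hp]
  have i1 := integrable_of_eq_zero_off_tsupport s1
    (contDiff_pdx (n := 0) (by simpa using c1)).continuous
    fun p => pdx_eq_zero_of_notMem_tsupport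
  have i2 := integrable_of_eq_zero_off_tsupport s2
    (contDiff_pdy (n := 0) (by simpa using c2)).continuous
    fun p => pdy_eq_zero_of_notMem_tsupport
  exact ⟨i1.add i2, by
    rw [integral_add i1 i2, integral_pdx_eq_zero c1 s1, integral_pdy_eq_zero c2 s2, add_zero]⟩

theorem sq_normG (w : ℝ × ℝ → ℝ) (p : ℝ × ℝ) : normG w p ^ 2 = Xg w p ^ 2 + Yg w p ^ 2 :=
  Real.sq_sqrt (by positivity)

theorem sq_normG_mul_curv (w : ℝ × ℝ → ℝ) (p : ℝ × ℝ) :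
    normG w p ^ 2 * (curvA w p ^ 2 + curvB w p ^ 2)
      = ((Yg w p * Xg (Xg w) p - Xg w p * Xg (Yg w) p) ^ 2
        + (Yg w p * Yg (Xg w) p - Xg w p * Yg (Yg w) p) ^ 2) / (Xg w p ^ 2 + Yg w p ^ 2) := by
  rw [← sq_normG]
  rcases eq_or_ne (normG w p) 0 with h | h
  · simp [h]
  · have h2 := sq_normG w p
    unfold curvA curvB
    field_simp
    rw [show normG w p ^ 2 = Xg w p ^ 2 + Yg w p ^ 2 from h2]
    ring

theorem cross_sq_div_add_inner_sq_div_le (a b s t : ℝ) {M : ℝ}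
    (hab : a ^ 2 + b ^ 2 ≤ M ^ 2) :
    (b * s - a * t) ^ 2 / (a ^ 2 + b ^ 2) + (a * s + b * t) ^ 2 / M ^ 2 ≤ s ^ 2 + t ^ 2 := by
  rcases (show 0 ≤ a ^ 2 + b ^ 2 by positivity).eq_or_lt with h | h
  · have ha : a = 0 := by nlinarith [sq_nonneg a, sq_nonneg b]
    have hb : b = 0 := by nlinarith [sq_nonneg a, sq_nonneg b]
    simp only [ha, hb]
    norm_num
    positivity
  · have h1 : (a * s + b * t) ^ 2 / M ^ 2 ≤ (a * s + b * t) ^ 2 / (a ^ 2 + b ^ 2) := by gcongr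
    have h2 : (b * s - a * t) ^ 2 / (a ^ 2 + b ^ 2) + (a * s + b * t) ^ 2 / (a ^ 2 + b ^ 2)
        = s ^ 2 + t ^ 2 := by
      field_simp
      ring
    linarith

theorem cross_add_grad_le (a b s t s' t' z zx zy : ℝ) {M : ℝ} (hM : 0 < M)
    (hab : a ^ 2 + b ^ 2 ≤ M ^ 2) :
    ((b * s - a * t) ^ 2 + (b * s' - a * t') ^ 2) / (a ^ 2 + b ^ 2) * z ^ 2
      + (((a * s + b * t) / M * z + M * zx) ^ 2 + ((a * s' + b * t') / M * z + M * zy) ^ 2)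
    ≤ (s ^ 2 + t ^ 2 + s' ^ 2 + t' ^ 2) * z ^ 2
      + 2 * z * ((a * s + b * t) * zx + (a * s' + b * t') * zy)
      + M ^ 2 * (zx ^ 2 + zy ^ 2) := by
  have h1 := mul_le_mul_of_nonneg_right
    (cross_sq_div_add_inner_sq_div_le a b s t hab) (sq_nonneg z)
  have h2 := mul_le_mul_of_nonneg_right
    (cross_sq_div_add_inner_sq_div_le a b s' t' hab) (sq_nonneg z)
  have e (c y : ℝ) : (c / M * z + M * y) ^ 2
      = c ^ 2 / M ^ 2 * z ^ 2 + 2 * z * (c * y) + M ^ 2 * y ^ 2 := by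
    field_simp
    ring
  rw [e, e, add_div]
  linarith

/-- The regularized norm `√((Xw)² + (Yw)² + ε²)`. -/
noncomputable def regNormG (ε : ℝ) (w : ℝ × ℝ → ℝ) (p : ℝ × ℝ) : ℝ :=
  Real.sqrt (Xg w p ^ 2 + Yg w p ^ 2 + ε ^ 2)

theorem sq_regNormG (ε : ℝ) (w : ℝ × ℝ → ℝ) (p : ℝ × ℝ) :
    regNormG ε w p ^ 2 = Xg w p ^ 2 + Yg w p ^ 2 + ε ^ 2 :=
  Real.sq_sqrt (by positivity)

theorem regNormG_pos {ε : ℝ} (hε : 0 < ε) (w : ℝ × ℝ → ℝ) (p : ℝ × ℝ) : 0 < regNormG ε w p :=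
  Real.sqrt_pos.2 (by positivity)

theorem normG_le_regNormG (ε : ℝ) (w : ℝ × ℝ → ℝ) (p : ℝ × ℝ) :
    normG w p ≤ regNormG ε w p :=
  Real.sqrt_le_sqrt (by nlinarith [sq_nonneg ε])

theorem normG_nonneg (w : ℝ × ℝ → ℝ) (p : ℝ × ℝ) : 0 ≤ normG w p :=
  Real.sqrt_nonneg _

theorem regNormG_le {ε : ℝ} (hε : 0 < ε) (w : ℝ × ℝ → ℝ) (p : ℝ × ℝ) :
    regNormG ε w p ≤ normG w p + ε := by
  have := normG_nonneg w p
  refine Real.sqrt_le_iff.2 ⟨by positivity, ?_⟩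
  nlinarith [sq_normG w p]

theorem contDiff_regNormG {ε : ℝ} (hε : 0 < ε) {w : ℝ × ℝ → ℝ} (hw : ContDiff ℝ 3 w) :
    ContDiff ℝ 2 (regNormG ε w) := by
  have hX : ContDiff ℝ 2 (Xg w) := contDiff_Xg (by norm_num; exact hw)
  have hY : ContDiff ℝ 2 (Yg w) := contDiff_Yg (by norm_num; exact hw)
  exact ContDiff.sqrt (by fun_prop) fun p => by positivity

theorem Xg_regNormG_mul {ε : ℝ} (hε : 0 < ε) {w ζ : ℝ × ℝ → ℝ} (hw : ContDiff ℝ 3 w)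
    (hζ : ContDiff ℝ 1 ζ) (p : ℝ × ℝ) :
    Xg (fun p => regNormG ε w p * ζ p) p
      = (Xg w p * Xg (Xg w) p + Yg w p * Xg (Yg w) p) / regNormG ε w p * ζ p
        + regNormG ε w p * Xg ζ p := by
  have hX : ContDiff ℝ 2 (Xg w) := contDiff_Xg (by norm_num; exact hw)
  have hY : ContDiff ℝ 2 (Yg w) := contDiff_Yg (by norm_num; exact hw)
  have h := (((((hasDerivAt_pdx (hX.differentiable (by simp)) p).pow 2).add
    ((hasDerivAt_pdx (hY.differentiable (by simp)) p).pow 2)).add_const (ε ^ 2)).sqrt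
      (by simp only [Pi.add_apply, Pi.pow_apply]; positivity)).mul
        (hasDerivAt_pdx (hζ.differentiable (by simp)) p)
  refine h.deriv.trans ?_
  have := regNormG_pos hε w p
  have e (f : ℝ × ℝ → ℝ) : Xg f p = pdx f p := rfl
  simp only [Pi.add_apply, Pi.pow_apply, Prod.mk.eta]
  rw [show √(Xg w p ^ 2 + Yg w p ^ 2 + ε ^ 2) = regNormG ε w p from rfl,
    e (Xg w), e (Yg w), e ζ]
  field_simp
  push_cast
  ring

theorem Yg_regNormG_mul {ε : ℝ} (hε : 0 < ε) {w ζ : ℝ × ℝ → ℝ} (hw : ContDiff ℝ 3 w)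
    (hζ : ContDiff ℝ 1 ζ) (p : ℝ × ℝ) :
    Yg (fun p => regNormG ε w p * ζ p) p
      = (Xg w p * Yg (Xg w) p + Yg w p * Yg (Yg w) p) / regNormG ε w p * ζ p
        + regNormG ε w p * Yg ζ p := by
  have hX : ContDiff ℝ 2 (Xg w) := contDiff_Xg (by norm_num; exact hw)
  have hY : ContDiff ℝ 2 (Yg w) := contDiff_Yg (by norm_num; exact hw)
  have h := (((((hasDerivAt_pdy (hX.differentiable (by simp)) p).pow 2).add
    ((hasDerivAt_pdy (hY.differentiable (by simp)) p).pow 2)).add_const (ε ^ 2)).sqrt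
      (by simp only [Pi.add_apply, Pi.pow_apply]; positivity)).mul
        (hasDerivAt_pdy (hζ.differentiable (by simp)) p)
  refine (congrArg (p.1 * ·) h.deriv).trans ?_
  have := regNormG_pos hε w p
  have e (f : ℝ × ℝ → ℝ) : Yg f p = p.1 * pdy f p := rfl
  rw [e (Xg w), e (Yg w), e ζ]
  simp only [Pi.add_apply, Pi.pow_apply, Prod.mk.eta]
  rw [show √(Xg w p ^ 2 + Yg w p ^ 2 + ε ^ 2) = regNormG ε w p from rfl]
  field_simp
  push_cast
  ring

theorem regNormG_mul_sub_le {ε : ℝ} (hε : 0 < ε) (hε1 : ε ≤ 1) (v w : ℝ × ℝ → ℝ) (p : ℝ × ℝ)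
    (c s t : ℝ) :
    c * ((regNormG ε v p * s) * (regNormG ε w p * t)) - c * (normG v p * normG w p * s * t)
      ≤ ε * (|c * (s * t)| * (normG v p + normG w p + 1)) := by
  have hv := normG_nonneg v p
  have hw := normG_nonneg w p
  have h0 : 0 ≤ regNormG ε v p * regNormG ε w p - normG v p * normG w p :=
    sub_nonneg.2 (mul_le_mul (normG_le_regNormG ε v p) (normG_le_regNormG ε w p) hw
      (hv.trans (normG_le_regNormG ε v p)))
  have h1 : regNormG ε v p * regNormG ε w p - normG v p * normG w p
      ≤ ε * (normG v p + normG w p + 1) := by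
    have := mul_le_mul (regNormG_le hε v p) (regNormG_le hε w p) (regNormG_pos hε w p).le
      (by positivity)
    nlinarith
  calc _ = c * (s * t) * (regNormG ε v p * regNormG ε w p - normG v p * normG w p) := by ring
    _ ≤ |c * (s * t)| * (regNormG ε v p * regNormG ε w p - normG v p * normG w p) :=
        mul_le_mul_of_nonneg_right (le_abs_self _) h0
    _ ≤ |c * (s * t)| * (ε * (normG v p + normG w p + 1)) :=
        mul_le_mul_of_nonneg_left h1 (abs_nonneg _)
    _ = _ := by ring

theorem integrable_curv_term {w ζ : ℝ × ℝ → ℝ} (hw : ContDiff ℝ 3 w) (hζ : Continuous ζ)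
    (hc : HasCompactSupport ζ) :
    Integrable fun p => normG w p ^ 2 * (curvA w p ^ 2 + curvB w p ^ 2) * ζ p ^ 2 := by
  have hX : ContDiff ℝ 2 (Xg w) := contDiff_Xg (by norm_num; exact hw)
  have hY : ContDiff ℝ 2 (Yg w) := contDiff_Yg (by norm_num; exact hw)
  have cX := hX.continuous
  have cY := hY.continuous
  have cXX := (contDiff_Xg (n := 1) (by norm_num; exact hX)).continuous
  have cYX := (contDiff_Yg (n := 1) (by norm_num; exact hX)).continuous
  have cXY := (contDiff_Xg (n := 1) (by norm_num; exact hY)).continuous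
  have cYY := (contDiff_Yg (n := 1) (by norm_num; exact hY)).continuous
  have hi : Integrable fun p => (Xg (Xg w) p ^ 2 + Xg (Yg w) p ^ 2 + Yg (Xg w) p ^ 2
      + Yg (Yg w) p ^ 2) * ζ p ^ 2 :=
    integrable_of_eq_zero_off_tsupport hc (by fun_prop) fun p hp => by
      simp [image_eq_zero_of_notMem_tsupport hp]
  simp only [sq_normG_mul_curv]
  refine hi.mono' (Measurable.aestronglyMeasurable ?_) (Eventually.of_forall fun p => ?_)
  · exact (Measurable.div (by fun_prop) (by fun_prop)).mul (by fun_prop)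
  · rw [Real.norm_of_nonneg (by positivity)]
    gcongr
    refine div_le_of_le_mul₀ (by positivity) (by positivity) ?_
    nlinarith [sq_nonneg (Xg w p * Xg (Xg w) p + Yg w p * Xg (Yg w) p),
      sq_nonneg (Xg w p * Yg (Xg w) p + Yg w p * Yg (Yg w) p)]

section Component

variable {m : ℕ} {w ζ : Fin m → ℝ × ℝ → ℝ} {c : Fin m → ℝ × ℝ → ℝ} {i : Fin m}

theorem geometric_pointwise (hw : ∀ i, ContDiff ℝ 3 (w i)) (hζ : ∀ i, ContDiff ℝ 1 (ζ i))
    {p : ℝ × ℝ}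
    (hX : ζ i p ≠ 0 → Xg (deltaG (w i)) p = ∑ j, c j p * Xg (w j) p)
    (hY : ζ i p ≠ 0 → Yg (deltaG (w i)) p = ∑ j, c j p * Yg (w j) p)
    {ε : ℝ} (hε : 0 < ε) (hε1 : ε ≤ 1) :
    normG (w i) p ^ 2 * (curvA (w i) p ^ 2 + curvB (w i) p ^ 2) * ζ i p ^ 2
      - 2 * ((Zg (Yg (w i)) p * Xg (w i) p - Zg (Xg (w i)) p * Yg (w i) p) * ζ i p ^ 2)
      + ∑ j, c j p * ((Xg (w i) p * Xg (w j) p + Yg (w i) p * Yg (w j) p) * ζ i p ^ 2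
          - normG (w i) p * normG (w j) p * ζ i p * ζ j p)
      + ∑ j, c j p * ((regNormG ε (w i) p * ζ i p) * (regNormG ε (w j) p * ζ j p))
      + (Xg (fun p => regNormG ε (w i) p * ζ i p) p ^ 2
        + Yg (fun p => regNormG ε (w i) p * ζ i p) p ^ 2)
    ≤ normG (w i) p ^ 2 * (Xg (ζ i) p ^ 2 + Yg (ζ i) p ^ 2)
      + (pdx (fun p => (Xg (w i) p * Xg (Xg (w i)) p
            + Yg (w i) p * Xg (Yg (w i)) p) * ζ i p ^ 2) p
        + pdy (fun p => p.1 * ((Xg (w i) p * Yg (Xg (w i)) p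
            + Yg (w i) p * Yg (Yg (w i)) p) * ζ i p ^ 2)) p)
      + ε * (∑ j, |c j p * (ζ i p * ζ j p)| * (normG (w i) p + normG (w j) p + 1)
        + (Xg (ζ i) p ^ 2 + Yg (ζ i) p ^ 2)) := by
  have hXw : ContDiff ℝ 2 (Xg (w i)) := contDiff_Xg (by norm_num; exact hw i)
  have hYw : ContDiff ℝ 2 (Yg (w i)) := contDiff_Yg (by norm_num; exact hw i)
  rw [pdx_add_pdy_flux hXw hYw (hζ i), Xg_regNormG_mul hε (hw i) (hζ i),
    Yg_regNormG_mul hε (hw i) (hζ i), sq_normG_mul_curv]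
  have hgrad := cross_add_grad_le (Xg (w i) p) (Yg (w i) p) (Xg (Xg (w i)) p) (Xg (Yg (w i)) p)
    (Yg (Xg (w i)) p) (Yg (Yg (w i)) p) (ζ i p) (Xg (ζ i) p) (Yg (ζ i) p)
    (regNormG_pos hε (w i) p) (by rw [sq_regNormG]; nlinarith)
  rw [sq_regNormG] at hgrad
  have hlap : (Xg (w i) p * (Xg (Xg (Xg (w i))) p + Yg (Yg (Xg (w i))) p)
      + Yg (w i) p * (Xg (Xg (Yg (w i))) p + Yg (Yg (Yg (w i))) p)) * ζ i p ^ 2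
      = ∑ j, c j p * (Xg (w i) p * Xg (w j) p + Yg (w i) p * Yg (w j) p) * ζ i p ^ 2
        - 2 * ((Zg (Yg (w i)) p * Xg (w i) p - Zg (Xg (w i)) p * Yg (w i) p) * ζ i p ^ 2) := by
    by_cases h : ζ i p = 0
    · simp [h]
    · have e : ∑ j, c j p * (Xg (w i) p * Xg (w j) p + Yg (w i) p * Yg (w j) p) * ζ i p ^ 2
          = (Xg (w i) p * ∑ j, c j p * Xg (w j) p
            + Yg (w i) p * ∑ j, c j p * Yg (w j) p) * ζ i p ^ 2 := by
        rw [Finset.mul_sum, Finset.mul_sum, ← Finset.sum_add_distrib, Finset.sum_mul]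
        exact Finset.sum_congr rfl fun j _ => by ring
      rw [e, ← hX h, ← hY h, Xg_deltaG (hw i), Yg_deltaG (hw i)]
      ring
  have hsum := Finset.sum_le_sum fun j (_ : j ∈ Finset.univ) =>
    regNormG_mul_sub_le hε hε1 (w i) (w j) p (c j p) (ζ i p) (ζ j p)
  rw [Finset.sum_sub_distrib, ← Finset.mul_sum] at hsum
  have hsplit : ∑ j, c j p * ((Xg (w i) p * Xg (w j) p + Yg (w i) p * Yg (w j) p) * ζ i p ^ 2
        - normG (w i) p * normG (w j) p * ζ i p * ζ j p)
      = ∑ j, c j p * (Xg (w i) p * Xg (w j) p + Yg (w i) p * Yg (w j) p) * ζ i p ^ 2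
        - ∑ j, c j p * (normG (w i) p * normG (w j) p * ζ i p * ζ j p) := by
    rw [← Finset.sum_sub_distrib]
    exact Finset.sum_congr rfl fun j _ => by ring
  have hεζ : ε ^ 2 * (Xg (ζ i) p ^ 2 + Yg (ζ i) p ^ 2)
      ≤ ε * (Xg (ζ i) p ^ 2 + Yg (ζ i) p ^ 2) :=
    mul_le_mul_of_nonneg_right (by nlinarith) (by positivity)
  rw [hlap, hsplit, sq_normG]
  linarith

theorem geometric_component (hw : ∀ i, ContDiff ℝ 3 (w i)) (hζ : ∀ i, ContDiff ℝ 1 (ζ i))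
    (hζc : ∀ i, HasCompactSupport (ζ i)) (hc : ∀ j, Continuous (c j))
    (hX : ∀ p, ζ i p ≠ 0 → Xg (deltaG (w i)) p = ∑ j, c j p * Xg (w j) p)
    (hY : ∀ p, ζ i p ≠ 0 → Yg (deltaG (w i)) p = ∑ j, c j p * Yg (w j) p) :
    ∃ K : ℝ, ∀ ε : ℝ, 0 < ε → ε ≤ 1 →
    (∫ p, normG (w i) p ^ 2 * (curvA (w i) p ^ 2 + curvB (w i) p ^ 2) * ζ i p ^ 2)
      - 2 * (∫ p, (Zg (Yg (w i)) p * Xg (w i) p - Zg (Xg (w i)) p * Yg (w i) p) * ζ i p ^ 2)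
      + (∑ j ∈ Finset.univ.erase i, ∫ p, c j p *
          ((Xg (w i) p * Xg (w j) p + Yg (w i) p * Yg (w j) p) * ζ i p ^ 2
          - normG (w i) p * normG (w j) p * ζ i p * ζ j p))
      + (∑ j, ∫ p, c j p * ((regNormG ε (w i) p * ζ i p) * (regNormG ε (w j) p * ζ j p)))
      + ∫ p, (Xg (fun p => regNormG ε (w i) p * ζ i p) p ^ 2
        + Yg (fun p => regNormG ε (w i) p * ζ i p) p ^ 2)
    ≤ (∫ p, normG (w i) p ^ 2 * (Xg (ζ i) p ^ 2 + Yg (ζ i) p ^ 2)) + ε * K := by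
  have hXw (j) : ContDiff ℝ 2 (Xg (w j)) := contDiff_Xg (by norm_num; exact hw j)
  have hYw (j) : ContDiff ℝ 2 (Yg (w j)) := contDiff_Yg (by norm_num; exact hw j)
  have cX (j) := (hXw j).continuous
  have cY (j) := (hYw j).continuous
  have cZX := (contDiff_Zg (n := 1) (by norm_num; exact hXw i)).continuous
  have cZY := (contDiff_Zg (n := 1) (by norm_num; exact hYw i)).continuous
  have cζ (j) := (hζ j).continuous
  have cXζ := (contDiff_Xg (n := 0) (by norm_num; exact hζ i)).continuous
  have cYζ := (contDiff_Yg (n := 0) (by norm_num; exact hζ i)).continuous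
  have cN (j) : Continuous (normG (w j)) := by
    have := cX j
    have := cY j
    unfold normG
    fun_prop
  have i1 := integrable_curv_term (hw i) (cζ i) (hζc i)
  have i2 : Integrable fun p =>
      (Zg (Yg (w i)) p * Xg (w i) p - Zg (Xg (w i)) p * Yg (w i) p) * ζ i p ^ 2 :=
    integrable_of_eq_zero_off_tsupport (hζc i) (by fun_prop) fun p hp => by
      simp [image_eq_zero_of_notMem_tsupport hp]
  have i3 (j) : Integrable fun p => c j p *
      ((Xg (w i) p * Xg (w j) p + Yg (w i) p * Yg (w j) p) * ζ i p ^ 2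
        - normG (w i) p * normG (w j) p * ζ i p * ζ j p) :=
    integrable_of_eq_zero_off_tsupport (hζc i) (by fun_prop) fun p hp => by
      simp [image_eq_zero_of_notMem_tsupport hp]
  have i4 : Integrable fun p => normG (w i) p ^ 2 * (Xg (ζ i) p ^ 2 + Yg (ζ i) p ^ 2) :=
    integrable_of_eq_zero_off_tsupport (hζc i) (by fun_prop) fun p hp => by
      simp [Xg_eq_zero_of_notMem_tsupport hp, Yg_eq_zero_of_notMem_tsupport hp]
  obtain ⟨i5, hflux⟩ := integral_flux_eq_zero (hXw i) (hYw i) (hζ i) (hζc i)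
  have i6 : Integrable fun p =>
      ∑ j, |c j p * (ζ i p * ζ j p)| * (normG (w i) p + normG (w j) p + 1)
        + (Xg (ζ i) p ^ 2 + Yg (ζ i) p ^ 2) :=
    integrable_of_eq_zero_off_tsupport (hζc i) (by fun_prop) fun p hp => by
      simp [Xg_eq_zero_of_notMem_tsupport hp, Yg_eq_zero_of_notMem_tsupport hp,
        image_eq_zero_of_notMem_tsupport hp]
  refine ⟨∫ p, (∑ j, |c j p * (ζ i p * ζ j p)| * (normG (w i) p + normG (w j) p + 1)
    + (Xg (ζ i) p ^ 2 + Yg (ζ i) p ^ 2)), fun ε hε hε1 => ?_⟩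
  have hψ : ContDiff ℝ 1 fun p => regNormG ε (w i) p * ζ i p :=
    ((contDiff_regNormG hε (hw i)).of_le (by norm_num)).mul (hζ i)
  have cR (j) := (contDiff_regNormG hε (hw j)).continuous
  have cXψ := (contDiff_Xg (n := 0) (by norm_num; exact hψ)).continuous
  have cYψ := (contDiff_Yg (n := 0) (by norm_num; exact hψ)).continuous
  have i7 (j) : Integrable fun p =>
      c j p * ((regNormG ε (w i) p * ζ i p) * (regNormG ε (w j) p * ζ j p)) :=
    integrable_of_eq_zero_off_tsupport (hζc i) (by fun_prop) fun p hp => by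
      simp [image_eq_zero_of_notMem_tsupport hp]
  have i8 : Integrable fun p => Xg (fun p => regNormG ε (w i) p * ζ i p) p ^ 2
        + Yg (fun p => regNormG ε (w i) p * ζ i p) p ^ 2 :=
    integrable_of_eq_zero_off_tsupport (hζc i) (by fun_prop) fun p hp => by
      have hp' : p ∉ tsupport fun p => regNormG ε (w i) p * ζ i p :=
        fun h => hp (tsupport_mul_subset_right h)
      simp [Xg_eq_zero_of_notMem_tsupport hp', Yg_eq_zero_of_notMem_tsupport hp']
  have hdiag : ∑ j ∈ Finset.univ.erase i, ∫ p, c j p *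
      ((Xg (w i) p * Xg (w j) p + Yg (w i) p * Yg (w j) p) * ζ i p ^ 2
        - normG (w i) p * normG (w j) p * ζ i p * ζ j p)
      = ∑ j, ∫ p, c j p *
      ((Xg (w i) p * Xg (w j) p + Yg (w i) p * Yg (w j) p) * ζ i p ^ 2
        - normG (w i) p * normG (w j) p * ζ i p * ζ j p) := by
    refine Finset.sum_erase _ ((integral_congr_ae (Eventually.of_forall fun p => ?_)).trans
      (integral_zero _ _))
    have := sq_normG (w i) p
    linear_combination -(c i p * ζ i p ^ 2) * this
  have hmono := integral_mono
    ((((i1.sub (i2.const_mul 2)).add (integrable_finsetSum Finset.univ fun j _ => i3 j)).add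
      (integrable_finsetSum Finset.univ fun j _ => i7 j)).add i8)
    ((i4.add i5).add (i6.const_mul ε))
    fun p => geometric_pointwise hw hζ (hX p) (hY p) hε hε1
  rw [integral_add' (((i1.sub (i2.const_mul 2)).add
        (integrable_finsetSum Finset.univ fun j _ => i3 j)).add
      (integrable_finsetSum Finset.univ fun j _ => i7 j)) i8,
    integral_add' ((i1.sub (i2.const_mul 2)).add
        (integrable_finsetSum Finset.univ fun j _ => i3 j))
      (integrable_finsetSum Finset.univ fun j _ => i7 j),
    integral_add' (i1.sub (i2.const_mul 2))
      (integrable_finsetSum Finset.univ fun j _ => i3 j),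
    integral_sub' i1 (i2.const_mul 2), integral_const_mul,
    integral_finsetSum _ fun j _ => i3 j, integral_finsetSum _ fun j _ => i7 j,
    integral_add' (i4.add i5) (i6.const_mul ε), integral_add' i4 i5, hflux,
    integral_const_mul, add_zero] at hmono
  rw [hdiag]
  exact hmono

end Component

theorem geometric_poincare_of_regularized_stable {m : ℕ} {w ζ : Fin m → ℝ × ℝ → ℝ}
    {c : Fin m → Fin m → ℝ × ℝ → ℝ} (hw : ∀ i, ContDiff ℝ 3 (w i))
    (hζ : ∀ i, ContDiff ℝ 1 (ζ i)) (hζc : ∀ i, HasCompactSupport (ζ i))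
    (hc : ∀ i j, Continuous (c i j))
    (hX : ∀ i p, ζ i p ≠ 0 → Xg (deltaG (w i)) p = ∑ j, c i j p * Xg (w j) p)
    (hY : ∀ i p, ζ i p ≠ 0 → Yg (deltaG (w i)) p = ∑ j, c i j p * Yg (w j) p)
    (hstab : ∀ ε : ℝ, 0 < ε →
      0 ≤ (∑ i, ∑ j, ∫ p, c i j p *
          ((regNormG ε (w i) p * ζ i p) * (regNormG ε (w j) p * ζ j p)))
        + ∑ i, ∫ p, (Xg (fun p => regNormG ε (w i) p * ζ i p) p ^ 2
          + Yg (fun p => regNormG ε (w i) p * ζ i p) p ^ 2)) :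
    (∑ i, ∫ p, normG (w i) p ^ 2 * (curvA (w i) p ^ 2 + curvB (w i) p ^ 2) * ζ i p ^ 2)
      - (2 * ∑ i, ∫ p,
          (Zg (Yg (w i)) p * Xg (w i) p - Zg (Xg (w i)) p * Yg (w i) p) * ζ i p ^ 2)
      + (∑ i, ∑ j ∈ Finset.univ.erase i, ∫ p, c i j p *
          ((Xg (w i) p * Xg (w j) p + Yg (w i) p * Yg (w j) p) * ζ i p ^ 2
          - normG (w i) p * normG (w j) p * ζ i p * ζ j p))
    ≤ ∑ i, ∫ p, normG (w i) p ^ 2 * (Xg (ζ i) p ^ 2 + Yg (ζ i) p ^ 2) := by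
  choose K hK using fun i => geometric_component hw hζ hζc (hc i) (hX i) (hY i)
  have key : ∀ ε : ℝ, 0 < ε → ε ≤ 1 →
      (∑ i, ∫ p, normG (w i) p ^ 2 * (curvA (w i) p ^ 2 + curvB (w i) p ^ 2) * ζ i p ^ 2)
      - (2 * ∑ i, ∫ p,
          (Zg (Yg (w i)) p * Xg (w i) p - Zg (Xg (w i)) p * Yg (w i) p) * ζ i p ^ 2)
      + (∑ i, ∑ j ∈ Finset.univ.erase i, ∫ p, c i j p *
          ((Xg (w i) p * Xg (w j) p + Yg (w i) p * Yg (w j) p) * ζ i p ^ 2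
          - normG (w i) p * normG (w j) p * ζ i p * ζ j p))
      ≤ (∑ i, ∫ p, normG (w i) p ^ 2 * (Xg (ζ i) p ^ 2 + Yg (ζ i) p ^ 2)) + ε * ∑ i, K i := by
    intro ε hε hε1
    have h := Finset.sum_le_sum fun i (_ : i ∈ Finset.univ) => hK i ε hε hε1
    simp only [Finset.sum_add_distrib, Finset.sum_sub_distrib, ← Finset.mul_sum] at h
    linarith [hstab ε hε]
  refine ge_of_tendsto (x := nhdsWithin 0 (Set.Ioi 0)) (f := fun ε : ℝ =>
    (∑ i, ∫ p, normG (w i) p ^ 2 * (Xg (ζ i) p ^ 2 + Yg (ζ i) p ^ 2)) + ε * ∑ i, K i) ?_ ?_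
  · refine tendsto_nhdsWithin_of_tendsto_nhds (Continuous.tendsto' (by fun_prop) _ _ (by simp))
  · filter_upwards [Ioc_mem_nhdsGT (zero_lt_one' ℝ)] with ε hε using key ε hε.1 hε.2

theorem hasDerivAt_comp_pi {m : ℕ} {H : (Fin m → ℝ) → ℝ} (hH : Differentiable ℝ H)
    {γ : Fin m → ℝ → ℝ} {γ' : Fin m → ℝ} {t : ℝ} (hγ : ∀ j, HasDerivAt (γ j) (γ' j) t) :
    HasDerivAt (fun s => H fun j => γ j s) (∑ j, pdH H j (fun k => γ k t) * γ' j) t := by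
  have h := HasFDerivAt.comp_hasDerivAt (f := fun s j => γ j s) t
    (hH fun j => γ j t).hasFDerivAt (hasDerivAt_pi.2 hγ)
  refine h.congr_deriv ?_
  rw [← Finset.univ_sum_single γ', map_sum]
  refine Finset.sum_congr rfl fun j _ => ?_
  rw [show (Pi.single j (γ' j) : Fin m → ℝ) = γ' j • Pi.single j 1 by
    rw [← Pi.single_smul]; simp, map_smul, smul_eq_mul, mul_comm, Finset.univ_sum_single]
  rfl

theorem Xg_comp_pi {m : ℕ} {H : (Fin m → ℝ) → ℝ} (hH : Differentiable ℝ H)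
    {w : Fin m → ℝ × ℝ → ℝ} (hw : ∀ j, Differentiable ℝ (w j)) (p : ℝ × ℝ) :
    Xg (fun q => H fun j => w j q) p = ∑ j, pdH H j (fun k => w k p) * Xg (w j) p :=
  (hasDerivAt_comp_pi hH fun j => hasDerivAt_pdx (hw j) p).deriv

theorem Yg_comp_pi {m : ℕ} {H : (Fin m → ℝ) → ℝ} (hH : Differentiable ℝ H)
    {w : Fin m → ℝ × ℝ → ℝ} (hw : ∀ j, Differentiable ℝ (w j)) (p : ℝ × ℝ) :
    Yg (fun q => H fun j => w j q) p = ∑ j, pdH H j (fun k => w k p) * Yg (w j) p := by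
  have h := (hasDerivAt_comp_pi hH fun j => hasDerivAt_pdy (hw j) p).deriv
  refine (congrArg (p.1 * ·) h).trans ?_
  simp only [Finset.mul_sum, Yg]
  exact Finset.sum_congr rfl fun j _ => mul_left_comm _ _ _

theorem setIntegral_eq_integral_of_tsupport {S : Set (ℝ × ℝ)} {f g ζ : ℝ × ℝ → ℝ}
    (hS : ∀ p ∈ tsupport ζ, p ∉ S → f p = 0) (hf : ∀ p ∉ tsupport ζ, f p = 0)
    (hg : ∀ p ∉ tsupport ζ, g p = 0) (h : ∀ p ∈ tsupport ζ, f p = g p) :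
    ∫ p in S, f p = ∫ p, g p := by
  rw [setIntegral_eq_integral_of_forall_compl_eq_zero fun p hp => ?_]
  · refine congrArg _ (funext fun p => ?_)
    by_cases hp : p ∈ tsupport ζ
    · exact h p hp
    · rw [hf p hp, hg p hp]
  · by_cases hp' : p ∈ tsupport ζ
    · exact hS p hp' hp
    · exact hf p hp'

/-- Geometric Poincaré inequality for stable solutions of the symmetric
Grushin system on an open set `Ω ⊆ ℝ²`, with the curvature terms `𝒜` and `ℬ`. -/
theorem stmt_4 {m : ℕ} (Ω : Set (ℝ × ℝ)) (hΩ : IsOpen Ω)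
    (H : Fin m → (Fin m → ℝ) → ℝ) (hH : ∀ i, ContDiff ℝ 1 (H i))
    (hsymm : ∀ i j v, pdH (H j) i v = pdH (H i) j v)
    (u : Fin m → ℝ × ℝ → ℝ) (hu : ∀ i, ContDiffOn ℝ 3 (u i) Ω)
    (hsys : ∀ i, ∀ p ∈ Ω, deltaG (u i) p = H i (fun j => u j p))
    -- stability: the stability inequality holds for all compactly supported C¹ test functions
    (hstab : ∀ ζ : Fin m → ℝ × ℝ → ℝ, (∀ i, ContDiff ℝ 1 (ζ i)) →
      (∀ i, HasCompactSupport (ζ i)) → (∀ i, tsupport (ζ i) ⊆ Ω) →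
      (-(∑ i, ∑ j, ∫ p in Ω, pdH (H j) i (fun k => u k p) * ζ i p * ζ j p))
        ≤ ∑ i, ∫ p in Ω, ((Xg (ζ i) p) ^ 2 + (Yg (ζ i) p) ^ 2))
    (ζ : Fin m → ℝ × ℝ → ℝ) (hζ : ∀ i, ContDiff ℝ 2 (ζ i))
    (hζc : ∀ i, HasCompactSupport (ζ i)) (hζΩ : ∀ i, tsupport (ζ i) ⊆ Ω) :
    (∑ i, ∫ p in Ω ∩ {q | normG (u i) q ≠ 0},
        (normG (u i) p) ^ 2 * ((curvA (u i) p) ^ 2 + (curvB (u i) p) ^ 2) * (ζ i p) ^ 2)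
      - (2 * ∑ i, ∫ p in Ω,
          (Zg (Yg (u i)) p * Xg (u i) p - Zg (Xg (u i)) p * Yg (u i) p) * (ζ i p) ^ 2)
      + (∑ i, ∑ j ∈ Finset.univ.erase i, ∫ p in Ω,
          pdH (H i) j (fun k => u k p) *
            ((Xg (u i) p * Xg (u j) p + Yg (u i) p * Yg (u j) p) * (ζ i p) ^ 2
              - normG (u i) p * normG (u j) p * ζ i p * ζ j p))
      ≤ ∑ i, ∫ p in Ω, (normG (u i) p) ^ 2 * ((Xg (ζ i) p) ^ 2 + (Yg (ζ i) p) ^ 2) := by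
  obtain ⟨V, hV, hKV, hVΩ, w, hw, hwu⟩ := exists_contDiff_eqOn_nhds (n := 3) hΩ
    (isCompact_iUnion fun i => (hζc i).isCompact) (Set.iUnion_subset hζΩ) u hu
  have hζV (i) : tsupport (ζ i) ⊆ V := (Set.subset_iUnion (fun i => tsupport (ζ i)) i).trans hKV
  have hw3 (i) : ContDiff ℝ 3 (w i) := hw i
  have hwd (i) : Differentiable ℝ (w i) := (hw3 i).differentiable (by simp)
  have hHd (i) : Differentiable ℝ (H i) := (hH i).differentiable (by simp)
  have hζ1 (i) : ContDiff ℝ 1 (ζ i) := (hζ i).of_le (by norm_num)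
  have hval {p} (hp : p ∈ V) : (fun k => u k p) = fun k => w k p :=
    funext fun k => (hwu k hp).symm
  have eX (i) : Set.EqOn (Xg (u i)) (Xg (w i)) V := Xg_congr hV (hwu i).symm
  have eY (i) : Set.EqOn (Yg (u i)) (Yg (w i)) V := Yg_congr hV (hwu i).symm
  have eXX (i) := Xg_congr hV (eX i)
  have eXY (i) := Xg_congr hV (eY i)
  have eYX (i) := Yg_congr hV (eX i)
  have eYY (i) := Yg_congr hV (eY i)
  have eZX (i) := Zg_congr hV (eX i)
  have eZY (i) := Zg_congr hV (eY i)
  have eN (i) : Set.EqOn (normG (u i)) (normG (w i)) V := fun p hp => by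
    simp only [normG, eX i hp, eY i hp]
  have eA (i) : Set.EqOn (curvA (u i)) (curvA (w i)) V := fun p hp => by
    simp only [curvA, eN i hp, eX i hp, eY i hp, eXX i hp, eXY i hp, eYX i hp, eYY i hp]
  have eB (i) : Set.EqOn (curvB (u i)) (curvB (w i)) V := fun p hp => by
    simp only [curvB, eN i hp, eX i hp, eY i hp, eXX i hp, eXY i hp, eYX i hp, eYY i hp]
  have eΔ (i) : Set.EqOn (deltaG (w i)) (fun q => H i fun j => w j q) V := fun p hp => by
    have h := hsys i p (hVΩ hp)
    rw [hval hp] at h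
    exact Eq.trans (by rw [deltaG, deltaG, eXX i hp, eYY i hp]) h
  have hsupp {i p} (h : ζ i p ≠ 0) : p ∈ V := hζV i (subset_tsupport _ h)
  have hcont (i j) : Continuous fun p => pdH (H i) j fun k => w k p := by
    have h1 : Continuous fun p => fun k => w k p := continuous_pi fun k => (hw3 k).continuous
    exact (((hH i).continuous_fderiv (by simp)).comp h1).clm_apply continuous_const
  have main := geometric_poincare_of_regularized_stable
    (c := fun i j p => pdH (H i) j fun k => w k p) hw3 hζ1 hζc hcont
    (fun i p h => (Xg_congr hV (eΔ i) (hsupp h)).trans (Xg_comp_pi (hHd i) hwd p))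
    (fun i p h => (Yg_congr hV (eΔ i) (hsupp h)).trans (Yg_comp_pi (hHd i) hwd p)) ?_
  · refine (congrArg₂ (· + ·) (congrArg₂ (· - ·) (Finset.sum_congr rfl fun i _ => ?_)
      (congrArg (2 * ·) (Finset.sum_congr rfl fun i _ => ?_)))
      (Finset.sum_congr rfl fun i _ => Finset.sum_congr rfl fun j _ => ?_)).trans_le
      (main.trans_eq (Finset.sum_congr rfl fun i _ => Eq.symm ?_))
    · refine setIntegral_eq_integral_of_tsupport (ζ := ζ i)
        (fun p hp hpS => ?_) (fun p hp => ?_) (fun p hp => ?_) fun p hp => ?_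
      · have : normG (u i) p = 0 := by
          by_contra h
          exact hpS ⟨hζΩ i hp, h⟩
        simp [this]
      · simp [image_eq_zero_of_notMem_tsupport hp]
      · simp [image_eq_zero_of_notMem_tsupport hp]
      · rw [eN i (hζV i hp), eA i (hζV i hp), eB i (hζV i hp)]
    · refine setIntegral_eq_integral_of_tsupport (ζ := ζ i)
        (fun p hp hpS => absurd (hζΩ i hp) hpS) (fun p hp => ?_) (fun p hp => ?_) fun p hp => ?_
      · simp [image_eq_zero_of_notMem_tsupport hp]
      · simp [image_eq_zero_of_notMem_tsupport hp]
      · have h := hζV i hp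
        rw [eZY i h, eZX i h, eX i h, eY i h]
    · refine setIntegral_eq_integral_of_tsupport (ζ := ζ i)
        (fun p hp hpS => absurd (hζΩ i hp) hpS) (fun p hp => ?_) (fun p hp => ?_) fun p hp => ?_
      · simp [image_eq_zero_of_notMem_tsupport hp]
      · simp [image_eq_zero_of_notMem_tsupport hp]
      · have h := hζV _ hp
        rw [hval h, eX _ h, eX _ h, eY _ h, eY _ h, eN _ h, eN _ h]
    · refine setIntegral_eq_integral_of_tsupport (ζ := ζ i)
        (fun p hp hpS => absurd (hζΩ i hp) hpS) (fun p hp => ?_) (fun p hp => ?_) fun p hp => ?_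
      · simp [Xg_eq_zero_of_notMem_tsupport hp, Yg_eq_zero_of_notMem_tsupport hp]
      · simp [Xg_eq_zero_of_notMem_tsupport hp, Yg_eq_zero_of_notMem_tsupport hp]
      · rw [eN _ (hζV _ hp)]
  · intro ε hε
    have hsub (i) : tsupport (fun p => regNormG ε (w i) p * ζ i p) ⊆ tsupport (ζ i) :=
      tsupport_mul_subset_right
    have h := hstab (fun i p => regNormG ε (w i) p * ζ i p)
      (fun i => ((contDiff_regNormG hε (hw3 i)).of_le (by norm_num)).mul (hζ1 i))
      (fun i => (hζc i).mul_left) fun i => (hsub i).trans (hζΩ i)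
    rw [neg_le_iff_add_nonneg, add_comm, Finset.sum_comm] at h
    refine h.trans_eq (congrArg₂ (· + ·) (Finset.sum_congr rfl fun i _ =>
      Finset.sum_congr rfl fun j _ => ?_) (Finset.sum_congr rfl fun i _ => ?_))
    · refine setIntegral_eq_integral_of_tsupport (ζ := ζ i)
        (fun p hp hpS => absurd (hζΩ i hp) hpS) (fun p hp => ?_) (fun p hp => ?_)
        fun p hp => ?_
      · simp [image_eq_zero_of_notMem_tsupport hp]
      · simp [image_eq_zero_of_notMem_tsupport hp]
      · rw [hval (hζV _ hp)]
        ring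
    · refine setIntegral_eq_integral_of_tsupport (ζ := ζ i)
        (fun p hp hpS => absurd (hζΩ i hp) hpS) (fun p hp => ?_) (fun p hp => ?_)
        fun p hp => rfl
      · have hp' := fun h => hp (hsub _ h)
        simp [Xg_eq_zero_of_notMem_tsupport hp', Yg_eq_zero_of_notMem_tsupport hp']
      · have hp' := fun h => hp (hsub _ h)
        simp [Xg_eq_zero_of_notMem_tsupport hp', Yg_eq_zero_of_notMem_tsupport hp']
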